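/- arXiv:2605.12794 — 6 statements merged into one kernel-verified Lean document; each statement's English description precedes it below -/
import Mathlib

section
/- Competitive ratio of EIP-1559 (Theorem 1): Consider blocks t = 1,…,T with target size B > 0 and hard cap 2B, and a finite set C of transactions, each j ∈ C having size q_j ≥ q_min > 0, per-unit value v_j with 0 < v_j ≤ v_max, and arrival time r_j ∈ {1,…,T}. Assume q_min ≤ B, η ≥ 0, and 0 < p_min < v_max. Suppose prices p_1,…,p_T satisfy p_1 ≥ p_min and p_{t+1} = max{p_min, p_t · exp(η(Q_t − B)/B)}, where Q_t is the total size of the transactions scheduled in block t. Suppose the schedule assigns a subset S ⊆ C of transactions to blocks, each j ∈ S to a block t_j with r_j ≤ t_j, such that: (i) every block is nonempty with Q_t ≥ q_min; (ii) every scheduled j satisfies v_j ≥ p_{t_j}; (iii) every scheduled j attains its maximal surplus, i.e. q_j(v_j − p_{t_j}) = max{0, max_{r_j ≤ t ≤ T} q_j(v_j − p_t)}; and (iv) every unscheduled j ∈ C \ S satisfies v_j ≤ p_t for all t with r_j ≤ t ≤ T. Then for every fractional schedule x with x_{jt} ≥ 0, x_{jt} = 0 when t < r_j, Σ_{t=1}^T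 x_{jt} ≤ 1 for every j, and Σ_{j∈C} q_j x_{jt} ≤ 2B for every t, one has Σ_{j∈C} Σ_{t=1}^T q_j v_j x_{jt} ≤ γ · Σ_{j∈S} q_j v_j, where γ = max{ 4B/(q_min · e^{η(q_min − B)/B}), 2(v_max − p_min)/v_max }. -/
/-- Weak duality for the scheduling linear program: nonnegative surpluses `u` and nonnegative prices
`p` that cover every feasible assignment bound the value of every fractional schedule. -/
theorem fractional_schedule_value_le {ι : Type*} (C : Finset ι) (q v u : ι → ℝ) (r : ι → ℕ)
    (T : ℕ) (cap : ℝ) (p : ℕ → ℝ) (x : ι → ℕ → ℝ)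
    (hp : ∀ t ∈ Finset.Icc 1 T, 0 ≤ p t) (hu : ∀ j ∈ C, 0 ≤ u j)
    (hcover : ∀ j ∈ C, ∀ t, r j ≤ t → t ≤ T → q j * (v j - p t) ≤ u j)
    (hx_nonneg : ∀ j ∈ C, ∀ t, 0 ≤ x j t)
    (hx_supp : ∀ j ∈ C, ∀ t, t < r j → x j t = 0)
    (hx_once : ∀ j ∈ C, ∑ t ∈ Finset.Icc 1 T, x j t ≤ 1)
    (hx_cap : ∀ t ∈ Finset.Icc 1 T, ∑ j ∈ C, q j * x j t ≤ cap) :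
    ∑ j ∈ C, ∑ t ∈ Finset.Icc 1 T, q j * v j * x j t ≤
      ∑ j ∈ C, u j + cap * ∑ t ∈ Finset.Icc 1 T, p t := by
  calc ∑ j ∈ C, ∑ t ∈ Finset.Icc 1 T, q j * v j * x j t
      ≤ ∑ j ∈ C, ∑ t ∈ Finset.Icc 1 T, (u j * x j t + p t * (q j * x j t)) := by
        refine Finset.sum_le_sum fun j hj => Finset.sum_le_sum fun t ht => ?_
        rcases lt_or_ge t (r j) with h | h
        · simp [hx_supp j hj t h]
        · have := mul_le_mul_of_nonneg_right
            (hcover j hj t h (Finset.mem_Icc.mp ht).2) (hx_nonneg j hj t)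
          linarith
    _ = ∑ j ∈ C, u j * ∑ t ∈ Finset.Icc 1 T, x j t +
          ∑ t ∈ Finset.Icc 1 T, p t * ∑ j ∈ C, q j * x j t := by
        simp only [Finset.sum_add_distrib, Finset.mul_sum]
        rw [Finset.sum_comm (s := C) (f := fun j t => p t * (q j * x j t))]
    _ ≤ ∑ j ∈ C, u j + ∑ t ∈ Finset.Icc 1 T, p t * cap := by
        refine add_le_add (Finset.sum_le_sum fun j hj => ?_) (Finset.sum_le_sum fun t ht => ?_)
        · exact mul_le_of_le_one_right (hu j hj) (hx_once j hj)
        · exact mul_le_mul_of_nonneg_left (hx_cap t ht) (hp t ht)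
    _ = ∑ j ∈ C, u j + cap * ∑ t ∈ Finset.Icc 1 T, p t := by
        rw [← Finset.sum_mul, mul_comm cap]


/-- Competitive ratio of EIP-1559 (Theorem 1). -/
theorem eip1559_competitive_ratio
    {ι : Type*} (C S : Finset ι) (hSC : S ⊆ C)
    (q v : ι → ℝ) (r tassign : ι → ℕ) (T : ℕ)
    (B qmin vmax η pmin : ℝ) (p Q : ℕ → ℝ) (x : ι → ℕ → ℝ)
    (hB : 0 < B) (hqmin : 0 < qmin) (hqminB : qmin ≤ B)
    (hη : 0 ≤ η) (hpmin : 0 < pmin) (hpminv : pmin < vmax)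
    (hq : ∀ j ∈ C, qmin ≤ q j)
    (hv_pos : ∀ j ∈ C, 0 < v j) (hv_ub : ∀ j ∈ C, v j ≤ vmax)
    (hr : ∀ j ∈ C, r j ∈ Finset.Icc 1 T)
    -- the price sequence follows the EIP-1559 update rule
    (hp1 : pmin ≤ p 1)
    (hupdate : ∀ t, 1 ≤ t → t < T →
      p (t + 1) = max pmin (p t * Real.exp (η * (Q t - B) / B)))
    -- Q t is the total size scheduled in block t
    (hQdef : ∀ t, Q t = ∑ j ∈ S.filter (fun j => tassign j = t), q j)
    -- each scheduled transaction is assigned to a block after its arrival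
    (htassign : ∀ j ∈ S, r j ≤ tassign j ∧ tassign j ≤ T)
    -- (i) every block is nonempty with Q t ≥ qmin
    (hblock : ∀ t ∈ Finset.Icc 1 T, qmin ≤ Q t)
    -- (ii) every scheduled transaction can afford its block's price
    (hafford : ∀ j ∈ S, p (tassign j) ≤ v j)
    -- (iii) every scheduled transaction attains its maximal surplus
    (hsurplus : ∀ j ∈ S, ∀ hne : (Finset.Icc (r j) T).Nonempty,
      q j * (v j - p (tassign j)) =
        max 0 ((Finset.Icc (r j) T).sup' hne (fun t => q j * (v j - p t))))
    -- (iv) every unscheduled transaction is priced out at all feasible blocks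
    (hunsched : ∀ j ∈ C, j ∉ S → ∀ t, r j ≤ t → t ≤ T → v j ≤ p t)
    -- x is an arbitrary feasible fractional (offline) schedule
    (hx_nonneg : ∀ j ∈ C, ∀ t, 0 ≤ x j t)
    (hx_supp : ∀ j ∈ C, ∀ t, t < r j → x j t = 0)
    (hx_once : ∀ j ∈ C, ∑ t ∈ Finset.Icc 1 T, x j t ≤ 1)
    (hx_cap : ∀ t ∈ Finset.Icc 1 T, ∑ j ∈ C, q j * x j t ≤ 2 * B) :
    ∑ j ∈ C, ∑ t ∈ Finset.Icc 1 T, q j * v j * x j t ≤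
      max (4 * B / (qmin * Real.exp (η * (qmin - B) / B)))
          (2 * (vmax - pmin) / vmax) *
        ∑ j ∈ S, q j * v j := by
  classical
  have hp : ∀ t ∈ Finset.Icc 1 T, 0 ≤ p t := by
    intro t ht
    obtain ⟨h1, hT⟩ := Finset.mem_Icc.mp ht
    obtain rfl | ⟨s, hs, rfl⟩ : t = 1 ∨ ∃ s, 1 ≤ s ∧ t = s + 1 := by
      rcases h1.eq_or_lt with h | h
      · exact Or.inl h.symm
      · exact Or.inr ⟨t - 1, by omega, by omega⟩
    · exact hpmin.le.trans hp1
    · rw [hupdate s hs (by omega)]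
      exact hpmin.le.trans (le_max_left _ _)
  have hq_nonneg : ∀ j ∈ S, 0 ≤ q j := fun j hj => hqmin.le.trans (hq j (hSC hj))
  set u : ι → ℝ := fun j => if j ∈ S then q j * (v j - p (tassign j)) else 0 with hu_def
  have hu : ∀ j ∈ C, 0 ≤ u j := by
    intro j _
    by_cases hj : j ∈ S
    · simpa [hu_def, hj] using mul_nonneg (hq_nonneg j hj) (sub_nonneg.mpr (hafford j hj))
    · simp [hu_def, hj]
  have hcover : ∀ j ∈ C, ∀ t, r j ≤ t → t ≤ T → q j * (v j - p t) ≤ u j := by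
    intro j hjC t hrt htT
    by_cases hj : j ∈ S
    · have hmem : t ∈ Finset.Icc (r j) T := Finset.mem_Icc.mpr ⟨hrt, htT⟩
      simp only [hu_def, hj, if_true]
      rw [hsurplus j hj ⟨t, hmem⟩]
      exact (Finset.le_sup' (fun t => q j * (v j - p t)) hmem).trans (le_max_right _ _)
    · simp only [hu_def, hj, if_false]
      exact mul_nonpos_of_nonneg_of_nonpos (hqmin.le.trans (hq j hjC))
        (sub_nonpos.mpr (hunsched j hjC hj t hrt htT))
  have hdual := fractional_schedule_value_le C q v u r T (2 * B) p x hp hu hcover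
    hx_nonneg hx_supp hx_once hx_cap
  have hrev : ∑ j ∈ S, q j * p (tassign j) = ∑ t ∈ Finset.Icc 1 T, Q t * p t := by
    have hmaps : ∀ j ∈ S, tassign j ∈ Finset.Icc 1 T := fun j hj =>
      Finset.mem_Icc.mpr
        ⟨(Finset.mem_Icc.mp (hr j (hSC hj))).1.trans (htassign j hj).1, (htassign j hj).2⟩
    rw [← Finset.sum_fiberwise_of_maps_to hmaps]
    refine Finset.sum_congr rfl fun t _ => ?_
    rw [hQdef t, Finset.sum_mul]
    refine Finset.sum_congr (by congr) fun j hj => ?_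
    rw [(Finset.mem_filter.mp hj).2]
  have husum : ∑ j ∈ C, u j = ∑ j ∈ S, q j * v j - ∑ t ∈ Finset.Icc 1 T, Q t * p t := by
    rw [← hrev, ← Finset.sum_sub_distrib, hu_def, ← Finset.sum_filter,
      Finset.filter_mem_eq_inter, Finset.inter_eq_right.mpr hSC]
    exact Finset.sum_congr rfl fun j _ => mul_sub _ _ _
  have hrev_le : ∑ t ∈ Finset.Icc 1 T, Q t * p t ≤ ∑ j ∈ S, q j * v j := by
    rw [← hrev]
    exact Finset.sum_le_sum fun j hj => mul_le_mul_of_nonneg_left (hafford j hj) (hq_nonneg j hj)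
  have hprice_le : qmin * ∑ t ∈ Finset.Icc 1 T, p t ≤ ∑ t ∈ Finset.Icc 1 T, Q t * p t := by
    rw [Finset.mul_sum]
    exact Finset.sum_le_sum fun t ht => mul_le_mul_of_nonneg_right (hblock t ht) (hp t ht)
  have hwelfare : 0 ≤ ∑ j ∈ S, q j * v j :=
    Finset.sum_nonneg fun j hj => mul_nonneg (hq_nonneg j hj) (hv_pos j (hSC hj)).le
  have hratio : 1 ≤ 2 * B / qmin := by
    rw [le_div_iff₀ hqmin]
    linarith
  have hgamma : 2 * B / qmin ≤ 4 * B / (qmin * Real.exp (η * (qmin - B) / B)) := by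
    have hexp : Real.exp (η * (qmin - B) / B) ≤ 1 := Real.exp_le_one_iff.mpr
      (div_nonpos_of_nonpos_of_nonneg
        (mul_nonpos_of_nonneg_of_nonpos hη (sub_nonpos.mpr hqminB)) hB.le)
    exact div_le_div₀ (by linarith) (by linarith) (by positivity)
      (mul_le_of_le_one_right hqmin.le hexp)
  have hcap : 2 * B * ∑ t ∈ Finset.Icc 1 T, p t ≤
      2 * B / qmin * ∑ t ∈ Finset.Icc 1 T, Q t * p t := by
    calc 2 * B * ∑ t ∈ Finset.Icc 1 T, p t
        = 2 * B / qmin * (qmin * ∑ t ∈ Finset.Icc 1 T, p t) := by field_simp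
      _ ≤ _ := mul_le_mul_of_nonneg_left hprice_le (by positivity)
  calc ∑ j ∈ C, ∑ t ∈ Finset.Icc 1 T, q j * v j * x j t
      ≤ 2 * B / qmin * ∑ j ∈ S, q j * v j := by
        have := mul_nonneg (sub_nonneg.mpr hratio) (sub_nonneg.mpr hrev_le)
        rw [husum] at hdual
        linarith
    _ ≤ _ := mul_le_mul_of_nonneg_right (hgamma.trans (le_max_left _ _)) hwelfare
end

section
/- One step of value iteration preserves convexity: Let B > 0, c_hold ∈ ℝ, c_over ≥ 0, γ ≥ 0, let a_1, …, a_N ∈ [0, 2B] and w_1, …, w_N ≥ 0 with Σ_{i=1}^N w_i = 1, and let J : [0, ∞) → ℝ be convex. Define, for s ≥ 0, F(s) := c_hold·s + min_{f ∈ [−B, min{s, 2B} − B]} [ c_over·max{f, 0} + γ · Σ_{i=1}^N w_i · J(s + a_i − f − B) ]. (Note that for −B ≤ f ≤ min{s,2B} − B and a_i ≥ 0 one has s + a_i − f − B ≥ 0, so F is well defined.) Then F is convex on [0, ∞). -/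
/-- A convex function on a half-line is bounded below on every bounded interval. -/
theorem ConvexOn.bddBelow_image_Icc_of_Ici {J : ℝ → ℝ} (hJ : ConvexOn ℝ (Set.Ici 0) J) (M : ℝ) :
    BddBelow (J '' Set.Icc 0 M) := by
  refine ⟨2 * J M - max (J 0) (J (2 * M)), ?_⟩
  rintro _ ⟨x, ⟨hx0, hxM⟩, rfl⟩
  have hM : 0 ≤ M := hx0.trans hxM
  have hreflect : J (2 * M - x) ≤ max (J 0) (J (2 * M)) :=
    hJ.le_max_of_mem_Icc (Set.mem_Ici.2 le_rfl) (Set.mem_Ici.2 (by linarith))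
      ⟨by linarith, by linarith⟩
  have hmid := hJ.2 (Set.mem_Ici.2 hx0) (Set.mem_Ici.2 (by linarith : 0 ≤ 2 * M - x))
    (by norm_num : (0 : ℝ) ≤ 1 / 2) (by norm_num : (0 : ℝ) ≤ 1 / 2) (by norm_num)
  simp only [smul_eq_mul] at hmid
  rw [show 1 / 2 * x + 1 / 2 * (2 * M - x) = M by ring] at hmid
  linarith

/-- Partial minimization of a jointly convex function over convexly varying fibres is convex. -/
theorem ConvexOn.sInf_image_fibre {E F : Type*} [AddCommGroup E] [Module ℝ E]
    [AddCommGroup F] [Module ℝ F] {K : Set E} {C : E → Set F} {G : E → F → ℝ}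
    (hK : Convex ℝ K) (hne : ∀ x ∈ K, (C x).Nonempty) (hbdd : ∀ x ∈ K, BddBelow (G x '' C x))
    (hG : ConvexOn ℝ {p : E × F | p.1 ∈ K ∧ p.2 ∈ C p.1} (fun p => G p.1 p.2)) :
    ConvexOn ℝ K (fun x => sInf (G x '' C x)) := by
  refine ⟨hK, fun x hx y hy a b ha hb hab => le_of_forall_pos_le_add fun ε hε => ?_⟩
  obtain ⟨_, ⟨u, hu, rfl⟩, hu'⟩ := exists_lt_of_csInf_lt ((hne x hx).image (G x))
    (lt_add_of_pos_right _ hε)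
  obtain ⟨_, ⟨v, hv, rfl⟩, hv'⟩ := exists_lt_of_csInf_lt ((hne y hy).image (G y))
    (lt_add_of_pos_right _ hε)
  have hxu : (x, u) ∈ {p : E × F | p.1 ∈ K ∧ p.2 ∈ C p.1} := ⟨hx, hu⟩
  have hyv : (y, v) ∈ {p : E × F | p.1 ∈ K ∧ p.2 ∈ C p.1} := ⟨hy, hv⟩
  calc sInf (G (a • x + b • y) '' C (a • x + b • y))
      ≤ G (a • x + b • y) (a • u + b • v) :=
        csInf_le (hbdd _ (hK hx hy ha hb hab))
          (Set.mem_image_of_mem _ (hG.1 hxu hyv ha hb hab).2)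
    _ ≤ a • G x u + b • G y v := hG.2 hxu hyv ha hb hab
    _ ≤ a • (sInf (G x '' C x) + ε) + b • (sInf (G y '' C y) + ε) := by gcongr
    _ = a • sInf (G x '' C x) + b • sInf (G y '' C y) + ε := by
        simp only [smul_eq_mul]
        linear_combination ε * hab

/-- One step of value iteration preserves convexity. -/
theorem value_iteration_preserves_convexity
    (B c_hold c_over γ : ℝ) (hB : 0 < B) (hc_over : 0 ≤ c_over) (hγ : 0 ≤ γ)
    (N : ℕ) (a w : Fin N → ℝ)
    (ha : ∀ i, a i ∈ Set.Icc 0 (2 * B))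
    (hw_nonneg : ∀ i, 0 ≤ w i) (hw_sum : ∑ i, w i = 1)
    (J : ℝ → ℝ) (hJ : ConvexOn ℝ (Set.Ici 0) J) :
    ConvexOn ℝ (Set.Ici 0) (fun s : ℝ =>
      c_hold * s + sInf ((fun f : ℝ =>
          c_over * max f 0 + γ * ∑ i, w i * J (s + a i - f - B)) ''
        Set.Icc (-B) (min s (2 * B) - B))) := by
  have hlin : ConvexOn ℝ (Set.Ici (0 : ℝ)) (fun s : ℝ => c_hold * s) :=
    (LinearMap.mul ℝ ℝ c_hold).convexOn (convex_Ici 0)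
  refine hlin.add (ConvexOn.sInf_image_fibre
    (G := fun s f => c_over * max f 0 + γ * ∑ i, w i * J (s + a i - f - B))
    (convex_Ici 0) (fun s hs => ?_) (fun s hs => ?_) ⟨?_, ?_⟩)
  · have : 0 ≤ min s (2 * B) := le_min hs (by linarith)
    exact Set.nonempty_Icc.2 (by linarith)
  · obtain ⟨m, hm⟩ := hJ.bddBelow_image_Icc_of_Ici (s + 2 * B)
    refine ⟨γ * m, ?_⟩
    rintro _ ⟨f, ⟨hf₁, hf₂⟩, rfl⟩
    have hmin := min_le_left s (2 * B)
    have hsum : m ≤ ∑ i, w i * J (s + a i - f - B) := by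
      calc m = ∑ i, w i * m := by rw [← Finset.sum_mul, hw_sum, one_mul]
        _ ≤ _ := Finset.sum_le_sum fun i _ => mul_le_mul_of_nonneg_left
            (hm (Set.mem_image_of_mem _
              ⟨by linarith [(ha i).1], by linarith [(ha i).2]⟩)) (hw_nonneg i)
    have h₁ := mul_le_mul_of_nonneg_left hsum hγ
    have h₂ := mul_nonneg hc_over (le_max_right f 0)
    dsimp only
    linarith
  · rintro ⟨s, f⟩ ⟨hs, hf₁, hf₂⟩ ⟨t, g⟩ ⟨ht, hg₁, hg₂⟩ p q hp hq hpq
    simp only [Set.mem_Ici, Set.mem_Icc, Set.mem_ofPred_eq, Prod.smul_mk, Prod.mk_add_mk,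
      smul_eq_mul, le_sub_iff_add_le, le_min_iff] at *
    refine ⟨by positivity, ?_, ?_, ?_⟩
    · nlinarith
    · nlinarith
    · nlinarith
  · rintro ⟨s, f⟩ ⟨hs, hf₁, hf₂⟩ ⟨t, g⟩ ⟨ht, hg₁, hg₂⟩ p q hp hq hpq
    simp only [Set.mem_Ici, Prod.smul_mk, Prod.mk_add_mk, smul_eq_mul, le_sub_iff_add_le,
      le_min_iff] at *
    have hmax : max (p * f + q * g) 0 ≤ p * max f 0 + q * max g 0 :=
      max_le (by gcongr <;> exact le_max_left _ _) (by positivity)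
    have hstep (i : Fin N) : J (p * s + q * t + a i - (p * f + q * g) - B) ≤
        p * J (s + a i - f - B) + q * J (t + a i - g - B) := by
      have h := hJ.2 (Set.mem_Ici.2 (by linarith [(ha i).1] : 0 ≤ s + a i - f - B))
        (Set.mem_Ici.2 (by linarith [(ha i).1] : 0 ≤ t + a i - g - B)) hp hq hpq
      simp only [smul_eq_mul] at h
      rwa [show p * (s + a i - f - B) + q * (t + a i - g - B) =
        p * s + q * t + a i - (p * f + q * g) - B by linear_combination (a i - B) * hpq] at h
    calc c_over * max (p * f + q * g) 0 +
          γ * ∑ i, w i * J (p * s + q * t + a i - (p * f + q * g) - B)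
        ≤ c_over * (p * max f 0 + q * max g 0) +
          γ * ∑ i, w i * (p * J (s + a i - f - B) + q * J (t + a i - g - B)) := by
          gcongr with i
          · exact hw_nonneg i
          · exact hstep i
      _ = _ := by
          simp only [mul_add, Finset.sum_add_distrib, Finset.mul_sum]
          simp only [mul_left_comm, add_assoc, add_left_comm]
end

section
/- One step of value iteration preserves monotonicity: Let B > 0, c_hold ≥ 0, c_over ≥ 0, γ ≥ 0, let a_1, …, a_N ∈ [0, 2B] and w_1, …, w_N ≥ 0 with Σ_{i=1}^N w_i = 1, and let J : [0, ∞) → ℝ be convex and nondecreasing. Define, for s ≥ 0, F(s) := c_hold·s + min_{f ∈ [−B, min{s, 2B} − B]} [ c_over·max{f, 0} + γ · Σ_{i=1}^N w_i · J(s + a_i − f − B) ]. Then F is nondecreasing on [0, ∞). -/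
/-- One step of value iteration preserves monotonicity. -/
theorem value_iteration_preserves_monotonicity
    (B c_hold c_over γ : ℝ) (hB : 0 < B) (hc_hold : 0 ≤ c_hold)
    (hc_over : 0 ≤ c_over) (hγ : 0 ≤ γ)
    (N : ℕ) (a w : Fin N → ℝ)
    (ha : ∀ i, a i ∈ Set.Icc 0 (2 * B))
    (hw_nonneg : ∀ i, 0 ≤ w i) (hw_sum : ∑ i, w i = 1)
    (J : ℝ → ℝ) (hJconv : ConvexOn ℝ (Set.Ici 0) J)
    (hJmono : MonotoneOn J (Set.Ici 0)) :
    MonotoneOn (fun s : ℝ =>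
      c_hold * s + sInf ((fun f : ℝ =>
          c_over * max f 0 + γ * ∑ i, w i * J (s + a i - f - B)) ''
        Set.Icc (-B) (min s (2 * B) - B))) (Set.Ici 0) := by
  have obj_mono : ∀ s t f g : ℝ, g ≤ f → 0 ≤ s - g - B → s - g - B ≤ t - f - B →
      c_over * max g 0 + γ * ∑ i, w i * J (s + a i - g - B) ≤
        c_over * max f 0 + γ * ∑ i, w i * J (t + a i - f - B) := by
    intro s t f g hgf h0 hle
    refine add_le_add (mul_le_mul_of_nonneg_left (max_le_max_right 0 hgf) hc_over)
      (mul_le_mul_of_nonneg_left (Finset.sum_le_sum fun i _ =>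
        mul_le_mul_of_nonneg_left (hJmono ?_ ?_ ?_) (hw_nonneg i)) hγ)
    · have := (ha i).1
      simp only [Set.mem_Ici]
      linarith
    · have := (ha i).1
      simp only [Set.mem_Ici]
      linarith
    · linarith
  intro s hs t ht hst
  simp only [Set.mem_Ici] at hs ht
  refine add_le_add (mul_le_mul_of_nonneg_left hst hc_hold) ?_
  refine le_csInf ((Set.nonempty_Icc.2 ?_).image _) ?_
  · linarith [le_min ht (by linarith : (0 : ℝ) ≤ 2 * B)]
  rintro _ ⟨f, ⟨hf₁, hf₂⟩, rfl⟩
  have hs_min := le_min hs (by linarith : (0 : ℝ) ≤ 2 * B)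
  have hbdd : BddBelow ((fun f : ℝ =>
      c_over * max f 0 + γ * ∑ i, w i * J (s + a i - f - B)) ''
        Set.Icc (-B) (min s (2 * B) - B)) := by
    refine ⟨c_over * max (-B) 0 + γ * ∑ i, w i * J (0 + a i - -B - B), ?_⟩
    rintro _ ⟨g, ⟨hg₁, hg₂⟩, rfl⟩
    refine obj_mono 0 s g (-B) hg₁ (by linarith) ?_
    linarith [min_le_left s (2 * B)]
  refine (csInf_le hbdd ⟨min f (min s (2 * B) - B),
    ⟨le_min hf₁ (by linarith), min_le_right _ _⟩, rfl⟩).trans ?_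
  refine obj_mono s t f _ (min_le_left _ _) ?_ ?_
  · linarith [min_le_right f (min s (2 * B) - B), min_le_left s (2 * B)]
  · have ht_min := min_le_left t (2 * B)
    have hB_min := min_le_right t (2 * B)
    rcases min_cases f (min s (2 * B) - B) with ⟨h, _⟩ | ⟨h, _⟩ <;>
      rcases min_cases s (2 * B) with ⟨h', _⟩ | ⟨h', _⟩ <;> linarith
end

section
/- All value-iteration iterates are convex and nondecreasing (Lemmas 5.1 and 5.2): Let B > 0, c_hold ≥ 0, c_over ≥ 0, c_term ≥ 0, γ ≥ 0, let a_1, …, a_N ∈ [0, 2B] and w_1, …, w_N ≥ 0 with Σ_{i=1}^N w_i = 1. Define J_0(s) := c_term·s for s ≥ 0, and inductively J_{k+1}(s) := c_hold·s + min_{f ∈ [−B, min{s, 2B} − B]} [ c_over·max{f, 0} + γ · Σ_{i=1}^N w_i · J_k(s + a_i − f − B) ] for s ≥ 0. Then for every k ∈ ℕ, the function J_k is convex and nondecreasing on [0, ∞). -/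
/-- Partial minimization of a jointly convex function over a convex graph of constraints
gives a convex function. -/
theorem convexOn_sInf_image {D : Set ℝ} (hD : Convex ℝ D) (F : ℝ → Set ℝ) (h : ℝ → ℝ → ℝ)
    (hne : ∀ s ∈ D, (F s).Nonempty) (hbdd : ∀ s ∈ D, BddBelow (h s '' F s))
    (hF : ∀ s ∈ D, ∀ t ∈ D, ∀ x ∈ F s, ∀ y ∈ F t, ∀ p q : ℝ, 0 ≤ p → 0 ≤ q → p + q = 1 →
      p * x + q * y ∈ F (p * s + q * t) ∧
        h (p * s + q * t) (p * x + q * y) ≤ p * h s x + q * h t y) :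
    ConvexOn ℝ D (fun s => sInf (h s '' F s)) := by
  refine ⟨hD, fun s hs t ht p q hp hq hpq => le_of_forall_pos_le_add fun ε hε => ?_⟩
  obtain ⟨_, ⟨x, hx, rfl⟩, hxε⟩ :=
    exists_lt_of_csInf_lt ((hne s hs).image (h s)) (lt_add_of_pos_right _ hε)
  obtain ⟨_, ⟨y, hy, rfl⟩, hyε⟩ :=
    exists_lt_of_csInf_lt ((hne t ht).image (h t)) (lt_add_of_pos_right _ hε)
  obtain ⟨hmem, hle⟩ := hF s hs t ht x hx y hy p q hp hq hpq
  have hst : p * s + q * t ∈ D := by simpa using hD hs ht hp hq hpq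
  simp only [smul_eq_mul]
  calc sInf (h (p * s + q * t) '' F (p * s + q * t))
      ≤ h (p * s + q * t) (p * x + q * y) :=
        csInf_le (hbdd _ hst) (Set.mem_image_of_mem _ hmem)
    _ ≤ p * h s x + q * h t y := hle
    _ ≤ p * (sInf (h s '' F s) + ε) + q * (sInf (h t '' F t) + ε) := by gcongr
    _ = p * sInf (h s '' F s) + q * sInf (h t '' F t) + ε := by
        linear_combination ε * hpq

/-- If every feasible choice at a larger state is dominated by a feasible choice at a smaller
state, then the optimal cost is monotone. -/
theorem monotoneOn_sInf_image {D : Set ℝ} (F : ℝ → Set ℝ) (h : ℝ → ℝ → ℝ)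
    (hne : ∀ s ∈ D, (F s).Nonempty) (hbdd : ∀ s ∈ D, BddBelow (h s '' F s))
    (hdom : ∀ s ∈ D, ∀ t ∈ D, s ≤ t → ∀ y ∈ F t, ∃ x ∈ F s, h s x ≤ h t y) :
    MonotoneOn (fun s => sInf (h s '' F s)) D := by
  intro s hs t ht hst
  refine le_csInf ((hne t ht).image _) ?_
  rintro _ ⟨y, hy, rfl⟩
  obtain ⟨x, hx, hxy⟩ := hdom s hs t ht hst y hy
  exact (csInf_le (hbdd s hs) (Set.mem_image_of_mem _ hx)).trans hxy

/-- All value-iteration iterates are convex and nondecreasing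
(Lemmas 5.1 and 5.2). -/
theorem value_iteration_iterates_convex_monotone
    (B c_hold c_over c_term γ : ℝ) (hB : 0 < B) (hc_hold : 0 ≤ c_hold)
    (hc_over : 0 ≤ c_over) (hc_term : 0 ≤ c_term) (hγ : 0 ≤ γ)
    (N : ℕ) (a w : Fin N → ℝ)
    (ha : ∀ i, a i ∈ Set.Icc 0 (2 * B))
    (hw_nonneg : ∀ i, 0 ≤ w i) (hw_sum : ∑ i, w i = 1)
    (J : ℕ → ℝ → ℝ)
    (hJ0 : ∀ s : ℝ, 0 ≤ s → J 0 s = c_term * s)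
    (hJsucc : ∀ (k : ℕ) (s : ℝ), 0 ≤ s →
      J (k + 1) s = c_hold * s + sInf ((fun f : ℝ =>
          c_over * max f 0 + γ * ∑ i, w i * J k (s + a i - f - B)) ''
        Set.Icc (-B) (min s (2 * B) - B))) :
    ∀ k : ℕ, ConvexOn ℝ (Set.Ici 0) (J k) ∧ MonotoneOn (J k) (Set.Ici 0) := by
  have hstate : ∀ {s f : ℝ} (i : Fin N), f ∈ Set.Icc (-B) (min s (2 * B) - B) →
      0 ≤ s + a i - f - B := fun {s f} i hf => by
    linarith [hf.2, min_le_left s (2 * B), (ha i).1]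
  intro k
  induction k with
  | zero =>
    have hJ : Set.EqOn (fun s => c_term * s) (J 0) (Set.Ici 0) := fun s hs => (hJ0 s hs).symm
    exact ⟨((convexOn_id (convex_Ici 0)).smul hc_term).congr hJ,
      ((monotone_id.const_mul hc_term).monotoneOn _).congr hJ⟩
  | succ k ih =>
    obtain ⟨hconv, hmono⟩ := ih
    set F : ℝ → Set ℝ := fun s => Set.Icc (-B) (min s (2 * B) - B)
    set h : ℝ → ℝ → ℝ := fun s f =>
      c_over * max f 0 + γ * ∑ i, w i * J k (s + a i - f - B)
    have hne : ∀ s ∈ Set.Ici (0 : ℝ), (F s).Nonempty := fun s hs => by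
      refine Set.nonempty_Icc.2 ?_
      linarith [le_min (Set.mem_Ici.1 hs) (by positivity : 0 ≤ 2 * B)]
    have hbdd : ∀ s ∈ Set.Ici (0 : ℝ), BddBelow (h s '' F s) := by
      rintro s -
      refine ⟨γ * ∑ i, w i * J k 0, ?_⟩
      rintro _ ⟨f, hf, rfl⟩
      refine le_add_of_nonneg_of_le (mul_nonneg hc_over (le_max_right _ _)) ?_
      refine mul_le_mul_of_nonneg_left (Finset.sum_le_sum fun i _ => ?_) hγ
      exact mul_le_mul_of_nonneg_left
        (hmono Set.self_mem_Ici (hstate i hf) (hstate i hf)) (hw_nonneg i)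
    have hJ : Set.EqOn (fun s => c_hold * s + sInf (h s '' F s)) (J (k + 1)) (Set.Ici 0) :=
      fun s hs => (hJsucc k s hs).symm
    constructor
    · refine (((convexOn_id (convex_Ici 0)).smul hc_hold).add
        (convexOn_sInf_image (convex_Ici 0) F h hne hbdd ?_)).congr hJ
      intro s _ t _ x hx y hy p q hp hq hpq
      refine ⟨⟨?_, ?_⟩, ?_⟩
      · nlinarith [hx.1, hy.1]
      · have hmin : p * min s (2 * B) + q * min t (2 * B) ≤ min (p * s + q * t) (2 * B) := by
          refine le_min ?_ ?_
          · gcongr <;> exact min_le_left _ _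
          · calc p * min s (2 * B) + q * min t (2 * B) ≤ p * (2 * B) + q * (2 * B) := by
                  gcongr <;> exact min_le_right _ _
              _ = 2 * B := by rw [← add_mul, hpq, one_mul]
        have hx' := mul_le_mul_of_nonneg_left hx.2 hp
        have hy' := mul_le_mul_of_nonneg_left hy.2 hq
        linear_combination hx' + hy' + hmin - B * hpq
      · have hmax : max (p * x + q * y) 0 ≤ p * max x 0 + q * max y 0 := by
          refine max_le ?_ (by positivity)
          gcongr <;> exact le_max_left _ _
        have hsum : ∑ i, w i * J k (p * s + q * t + a i - (p * x + q * y) - B) ≤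
            p * ∑ i, w i * J k (s + a i - x - B) + q * ∑ i, w i * J k (t + a i - y - B) := by
          rw [Finset.mul_sum, Finset.mul_sum, ← Finset.sum_add_distrib]
          refine Finset.sum_le_sum fun i _ => ?_
          have hi := hconv.2 (hstate i hx) (hstate i hy) hp hq hpq
          simp only [smul_eq_mul] at hi
          rw [show p * s + q * t + a i - (p * x + q * y) - B =
            p * (s + a i - x - B) + q * (t + a i - y - B) by
              linear_combination (B - a i) * hpq]
          linear_combination mul_le_mul_of_nonneg_left hi (hw_nonneg i)
        linear_combination mul_le_mul_of_nonneg_left hmax hc_over +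
          mul_le_mul_of_nonneg_left hsum hγ
    · refine (((monotone_id.const_mul hc_hold).monotoneOn _).add
        (monotoneOn_sInf_image F h hne hbdd ?_)).congr hJ
      intro s hs t _ hst y hy
      have hx : min y (min s (2 * B) - B) ∈ F s :=
        ⟨le_min hy.1 (Set.nonempty_Icc.1 (hne s hs)), min_le_right _ _⟩
      have hres : s - min y (min s (2 * B) - B) ≤ t - y := by
        have hyt := hy.2
        grind
      refine ⟨_, hx, ?_⟩
      refine add_le_add (mul_le_mul_of_nonneg_left (max_le_max_right 0 (min_le_left _ _)) hc_over)
        (mul_le_mul_of_nonneg_left (Finset.sum_le_sum fun i _ => ?_) hγ)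
      exact mul_le_mul_of_nonneg_left
        (hmono (hstate i hx) (hstate i hy) (by linarith)) (hw_nonneg i)
end

section
/- Optimality of threshold scheduling policies in the homogeneous dynamic scheduling problem: Let B > 0 and c_over > 0, let g : [0, ∞) → ℝ be convex and nondecreasing, and suppose x* ∈ [0, ∞) minimizes y ↦ g(y) − c_over·y over [0, ∞). Set s* := B + x* (so s* ≥ B), and define f* : [0, ∞) → ℝ by f*(s) := min{s − B, 0} for 0 ≤ s ≤ s* and f*(s) := min{s − s*, B} for s > s*. Then for every s ≥ 0: (a) f*(s) lies in the feasible interval [−B, min{s, 2B} − B]; and (b) for every f ∈ [−B, min{s, 2B} − B], c_over·max{f*(s), 0} + g(s − f*(s) − B) ≤ c_over·max{f, 0} + g(s − f − B). In other words, the threshold policy f* minimizes the one-step Bellman objective at every state. -/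
/-- A convex function does not increase when its argument moves towards a minimizer. -/
theorem ConvexOn.le_of_mem_segment_of_isMinOn {E : Type*} [AddCommGroup E] [Module ℝ E]
    {S : Set E} {h : E → ℝ} (hconv : ConvexOn ℝ S h) {x p q : E} (hx : x ∈ S) (hq : q ∈ S)
    (hmin : IsMinOn h S x) (hp : p ∈ segment ℝ x q) : h p ≤ h q :=
  (hconv.le_on_segment hx hq hp).trans (max_le (hmin hq) le_rfl)

/-- Optimality of threshold scheduling policies in the homogeneous dynamic
scheduling problem (Theorem 5.3). -/
theorem threshold_policy_optimal
    (B c_over : ℝ) (hB : 0 < B) (hc_over : 0 < c_over)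
    (g : ℝ → ℝ) (hgconv : ConvexOn ℝ (Set.Ici 0) g)
    (hgmono : MonotoneOn g (Set.Ici 0))
    (xstar : ℝ) (hxstar : 0 ≤ xstar)
    (hmin : ∀ y ∈ Set.Ici (0 : ℝ),
      g xstar - c_over * xstar ≤ g y - c_over * y)
    (fstar : ℝ → ℝ)
    (hf_low : ∀ s : ℝ, 0 ≤ s → s ≤ B + xstar → fstar s = min (s - B) 0)
    (hf_high : ∀ s : ℝ, B + xstar < s → fstar s = min (s - (B + xstar)) B) :
    ∀ s : ℝ, 0 ≤ s →
      fstar s ∈ Set.Icc (-B) (min s (2 * B) - B) ∧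
      ∀ f ∈ Set.Icc (-B) (min s (2 * B) - B),
        c_over * max (fstar s) 0 + g (s - fstar s - B) ≤
          c_over * max f 0 + g (s - f - B) := by
  have hlin : ConcaveOn ℝ (Set.Ici (0 : ℝ)) fun y => c_over * y :=
    (concaveOn_id (convex_Ici 0)).smul hc_over.le
  have toward : ∀ p q : ℝ, 0 ≤ q → p ∈ segment ℝ xstar q →
      g p - c_over * p ≤ g q - c_over * q := fun p q hq hp =>
    (hgconv.sub hlin).le_of_mem_segment_of_isMinOn hxstar hq hmin hp
  have mono : ∀ p q : ℝ, 0 ≤ p → p ≤ q → g p ≤ g q := fun p q hp hpq =>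
    hgmono hp (hp.trans hpq) hpq
  -- It suffices to beat the nonnegative overshoots, as undershooting leaves a larger pool.
  have beats_all : ∀ s a : ℝ, B ≤ s → 0 ≤ a →
      (∀ f, 0 ≤ f → f ≤ B → f ≤ s - B →
        c_over * a + g (s - a - B) ≤ c_over * f + g (s - f - B)) →
      ∀ f ∈ Set.Icc (-B) (min s (2 * B) - B),
        c_over * max a 0 + g (s - a - B) ≤ c_over * max f 0 + g (s - f - B) := by
    intro s a hs ha hbest f hf
    have hfs : f ≤ s - B := by linarith [hf.2, min_le_left s (2 * B)]
    have hfB : f ≤ B := by linarith [hf.2, min_le_right s (2 * B)]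
    rw [max_eq_left ha]
    rcases le_total 0 f with h0 | h0
    · rw [max_eq_left h0]
      exact hbest f h0 hfB hfs
    · rw [max_eq_right h0]
      exact (hbest 0 le_rfl hB.le (by linarith)).trans
        (by gcongr; exact mono _ _ (by linarith) (by linarith))
  intro s hs
  rcases le_or_gt s (B + xstar) with hlow | hhigh
  · rw [hf_low s hs hlow]
    rcases le_total s B with hsB | hsB
    · rw [min_eq_left (by linarith : s - B ≤ 0), min_eq_left (by linarith : s ≤ 2 * B)]
      refine ⟨⟨by linarith, le_rfl⟩, fun f hf => ?_⟩
      rw [max_eq_right (by linarith : s - B ≤ 0), max_eq_right (by linarith [hf.2])]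
      gcongr
      exact mono _ _ (by linarith) (by linarith [hf.2])
    · rw [min_eq_right (by linarith : 0 ≤ s - B)]
      refine ⟨⟨by linarith, sub_nonneg.2 (le_min hsB (by linarith))⟩,
        beats_all s 0 hsB le_rfl fun f h0 _ hfs => ?_⟩
      have := toward (s - 0 - B) (s - f - B) (by linarith) (by
        rw [segment_symm, segment_eq_Icc (by linarith)]
        exact ⟨by linarith, by linarith⟩)
      linarith
  · rw [hf_high s hhigh]
    have hpos : 0 ≤ min (s - (B + xstar)) B := le_min (by linarith) hB.le
    have hexcess := min_le_left (s - (B + xstar)) B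
    have hcap := min_le_right (s - (B + xstar)) B
    refine ⟨⟨by linarith, le_sub_iff_add_le.2 (le_min (by linarith) (by linarith))⟩,
      beats_all s _ (by linarith) hpos fun f h0 hfB hfs => ?_⟩
    rcases le_total (s - (B + xstar)) B with h | h
    · rw [min_eq_left h, show s - (s - (B + xstar)) - B = xstar by ring]
      have := hmin (s - f - B) (Set.mem_Ici.2 (by linarith))
      linarith
    · rw [min_eq_right h]
      have := toward (s - B - B) (s - f - B) (by linarith) (by
        rw [segment_eq_Icc (by linarith)]
        exact ⟨by linarith, by linarith⟩)
      linarith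
end

section
/- Feasibility condition for the bang–bang cycle length (arithmetic core of Theorem 6.3): Let Q > 0 be a real number, let n ≥ 2 be an integer, and let B be a real number with B > Q. Then Q(n−1)/(B − Q) ≤ (2B − Q)/(Q(n−1)) if and only if (Q/4)·(3 + √(8n² − 16n + 9)) ≤ B. Moreover, nQ/2 < (Q/4)·(3 + √(8n² − 16n + 9)). -/
/-- Feasibility condition for the bang–bang cycle length
(arithmetic core of Theorem 6.3). -/
theorem bangbang_cycle_feasibility
    (Q B : ℝ) (n : ℕ) (hQ : 0 < Q) (hn : 2 ≤ n) (hBQ : Q < B) :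
    (Q * ((n : ℝ) - 1) / (B - Q) ≤ (2 * B - Q) / (Q * ((n : ℝ) - 1)) ↔
      (Q / 4) * (3 + Real.sqrt (8 * (n : ℝ) ^ 2 - 16 * (n : ℝ) + 9)) ≤ B) ∧
    (n : ℝ) * Q / 2 <
      (Q / 4) * (3 + Real.sqrt (8 * (n : ℝ) ^ 2 - 16 * (n : ℝ) + 9)) := by
  have hn' : (2 : ℝ) ≤ n := by exact_mod_cast hn
  have hden : 0 < Q * ((n : ℝ) - 1) := mul_pos hQ (by linarith)
  constructor
  · rw [div_le_div_iff₀ (sub_pos.mpr hBQ) hden]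
    calc
      _ ↔ 8 * (n : ℝ) ^ 2 - 16 * (n : ℝ) + 9 ≤ ((4 * B - 3 * Q) / Q) ^ 2 := by
        rw [div_pow, le_div_iff₀ (pow_pos hQ 2)]
        constructor <;> intro h <;> linarith
      _ ↔ Real.sqrt (8 * (n : ℝ) ^ 2 - 16 * (n : ℝ) + 9) ≤ (4 * B - 3 * Q) / Q :=
        (Real.sqrt_le_left (div_nonneg (by linarith) hQ.le)).symm
      _ ↔ _ := by
        rw [le_div_iff₀ hQ]
        constructor <;> intro h <;> linarith
  · have hsqrt : 2 * (n : ℝ) - 3 < Real.sqrt (8 * (n : ℝ) ^ 2 - 16 * (n : ℝ) + 9) :=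
      Real.lt_sqrt_of_sq_lt (by nlinarith)
    linarith [mul_lt_mul_of_pos_left hsqrt hQ]
end
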